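/- Let α ∈ [1/2,1)∪(1,∞). For any quantum channels N: A₁→B₁ and M: A₂→B₂, the α-Tsallis channel entropy is pseudo-additive: S̃^T_α(N⊗M) = S̃^T_α(N) + S̃^T_α(M) + (1−α)·S̃^T_α(N)·S̃^T_α(M). -/

import Mathlib

open scoped Kronecker ComplexOrder

noncomputable section

namespace QIT

variable {n : Type*} [Fintype n] [DecidableEq n]

/-- Real trace of a complex matrix. -/
def rtr (A : Matrix n n ℂ) : ℝ := (Matrix.trace A).re

/-- Apply a real function to a hermitian matrix via spectral decomposition
(junk value `0` for non-hermitian input). -/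
def mfun (f : ℝ → ℝ) (A : Matrix n n ℂ) : Matrix n n ℂ :=
  if hA : A.IsHermitian then
    (Matrix.IsHermitian.eigenvectorUnitary hA : Matrix n n ℂ) *
      Matrix.diagonal (fun i => ((f (hA.eigenvalues i) : ℝ) : ℂ)) *
      (star (Matrix.IsHermitian.eigenvectorUnitary hA : Matrix n n ℂ))
  else 0

/-- Real power of a positive semidefinite matrix (with the conventions
`0 ^ p = 0` for `p ≠ 0`, i.e. powers are taken on the support). -/
def mpow (A : Matrix n n ℂ) (p : ℝ) : Matrix n n ℂ := mfun (fun x => x ^ p) A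

/-- Matrix base-2 logarithm (on the support). -/
def mlog (A : Matrix n n ℂ) : Matrix n n ℂ := mfun (Real.logb 2) A

/-- A quantum state: positive semidefinite with unit trace. -/
def IsState (ρ : Matrix n n ℂ) : Prop := ρ.PosSemidef ∧ Matrix.trace ρ = 1

/-- A pure state: a state of rank one. -/
def IsPureState (ρ : Matrix n n ℂ) : Prop := IsState ρ ∧ ρ.rank = 1

/-- The support (range) ordering: `supp ρ ⊆ supp σ`, expressed as
`ker σ ≤ ker ρ`. -/
def SuppLE (ρ σ : Matrix n n ℂ) : Prop := ∀ v : n → ℂ, σ.mulVec v = 0 → ρ.mulVec v = 0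

/-- Trace norm ‖X‖₁ = Tr √(X† X). -/
def traceNorm (X : Matrix n n ℂ) : ℝ := rtr (mpow (X.conjTranspose * X) (2⁻¹ : ℝ))

/-- von Neumann entropy (base 2). -/
def vnEnt (ρ : Matrix n n ℂ) : ℝ := - rtr (ρ * mlog ρ)

/-- Umegaki relative entropy (base 2), real-valued on its finiteness domain. -/
def relEnt (ρ σ : Matrix n n ℂ) : ℝ := rtr (ρ * mlog ρ) - rtr (ρ * mlog σ)

/-- The sandwiched trace functional Tr{(σ^((1-α)/(2α)) ρ σ^((1-α)/(2α)))^α}. -/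
def sandTr (α : ℝ) (ρ σ : Matrix n n ℂ) : ℝ :=
  rtr (mpow (mpow σ ((1 - α) / (2 * α)) * ρ * mpow σ ((1 - α) / (2 * α))) α)

/-- Sandwiched Rényi relative entropy (base 2). -/
def sandRenyi (α : ℝ) (ρ σ : Matrix n n ℂ) : ℝ := (α - 1)⁻¹ * Real.logb 2 (sandTr α ρ σ)

/-- Sandwiched Tsallis relative entropy. -/
def sandTsallis (α : ℝ) (ρ σ : Matrix n n ℂ) : ℝ := (α - 1)⁻¹ * (sandTr α ρ σ - 1)

/-- (Non-sandwiched) Tsallis relative entropy. -/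
def tsallisRel (α : ℝ) (ρ σ : Matrix n n ℂ) : ℝ :=
  (α - 1)⁻¹ * (rtr (mpow ρ α * mpow σ (1 - α)) - 1)

/-- Tsallis entropy of a state. -/
def tsallisEnt (α : ℝ) (ρ : Matrix n n ℂ) : ℝ := (1 - α)⁻¹ * (rtr (mpow ρ α) - 1)

variable {a b c r : Type*} [Fintype a] [DecidableEq a] [Fintype b] [DecidableEq b]
  [Fintype c] [DecidableEq c] [Fintype r] [DecidableEq r]

/-- Partial trace over the first tensor factor. -/
def ptraceA (ρ : Matrix (a × b) (a × b) ℂ) : Matrix b b ℂ :=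
  Matrix.of fun i j => ∑ k : a, ρ (k, i) (k, j)

/-- Partial trace over the second tensor factor. -/
def ptraceB (ρ : Matrix (a × b) (a × b) ℂ) : Matrix a a ℂ :=
  Matrix.of fun i j => ∑ k : b, ρ (i, k) (j, k)

/-- Conditional sandwiched Rényi entropy H̃↓_α(A|B). -/
def condRenyiDown (α : ℝ) (ρ : Matrix (a × b) (a × b) ℂ) : ℝ :=
  - sandRenyi α ρ ((1 : Matrix a a ℂ) ⊗ₖ ptraceA ρ)

/-- Conditional sandwiched Tsallis entropy T̃↓_α(A|B). -/
def condTsallisSandDown (α : ℝ) (ρ : Matrix (a × b) (a × b) ℂ) : ℝ :=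
  - sandTsallis α ρ ((1 : Matrix a a ℂ) ⊗ₖ ptraceA ρ)

/-- Optimized conditional sandwiched Tsallis entropy T̃↑_α(A|B). -/
def condTsallisSandUp (α : ℝ) (ρ : Matrix (a × b) (a × b) ℂ) : ℝ :=
  - ⨅ σ : {σ : Matrix b b ℂ // IsState σ}, sandTsallis α ρ ((1 : Matrix a a ℂ) ⊗ₖ σ.1)

/-- Conditional (non-sandwiched) Tsallis entropy T↓_α(A|B). -/
def condTsallisDown (α : ℝ) (ρ : Matrix (a × b) (a × b) ℂ) : ℝ :=
  - tsallisRel α ρ ((1 : Matrix a a ℂ) ⊗ₖ ptraceA ρ)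

/-- Conditional von Neumann entropy H(A|B) = S(AB) - S(B). -/
def condvnEnt (ρ : Matrix (a × b) (a × b) ℂ) : ℝ := vnEnt ρ - vnEnt (ptraceA ρ)

/-- The extension `N ⊗ I_r` of a linear map on matrices. -/
def tensorId (N : Matrix a a ℂ →ₗ[ℂ] Matrix b b ℂ) (r : Type*) [Fintype r] [DecidableEq r] :
    Matrix (a × r) (a × r) ℂ →ₗ[ℂ] Matrix (b × r) (b × r) ℂ where
  toFun ρ := Matrix.of fun p q => N (Matrix.of fun x y => ρ (x, p.2) (y, q.2)) p.1 q.1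
  map_add' ρ₁ ρ₂ := by
    ext p q
    have h : (Matrix.of fun x y => (ρ₁ + ρ₂) (x, p.2) (y, q.2))
        = (Matrix.of fun x y => ρ₁ (x, p.2) (y, q.2))
          + (Matrix.of fun x y => ρ₂ (x, p.2) (y, q.2)) := by
      ext x y; simp
    show N (Matrix.of fun x y => (ρ₁ + ρ₂) (x, p.2) (y, q.2)) p.1 q.1 = _
    rw [h, map_add]; rfl
  map_smul' z ρ := by
    ext p q
    have h : (Matrix.of fun x y => (z • ρ) (x, p.2) (y, q.2))
        = z • (Matrix.of fun x y => ρ (x, p.2) (y, q.2)) := by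
      ext x y; simp
    show N (Matrix.of fun x y => (z • ρ) (x, p.2) (y, q.2)) p.1 q.1 = _
    rw [h, map_smul]; rfl

/-- The extension `I_r ⊗ M` of a linear map on matrices. -/
def idTensor (M : Matrix a a ℂ →ₗ[ℂ] Matrix b b ℂ) (r : Type*) [Fintype r] [DecidableEq r] :
    Matrix (r × a) (r × a) ℂ →ₗ[ℂ] Matrix (r × b) (r × b) ℂ where
  toFun ρ := Matrix.of fun p q => M (Matrix.of fun x y => ρ (p.1, x) (q.1, y)) p.2 q.2
  map_add' ρ₁ ρ₂ := by
    ext p q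
    have h : (Matrix.of fun x y => (ρ₁ + ρ₂) (p.1, x) (q.1, y))
        = (Matrix.of fun x y => ρ₁ (p.1, x) (q.1, y))
          + (Matrix.of fun x y => ρ₂ (p.1, x) (q.1, y)) := by
      ext x y; simp
    show M (Matrix.of fun x y => (ρ₁ + ρ₂) (p.1, x) (q.1, y)) p.2 q.2 = _
    rw [h, map_add]; rfl
  map_smul' z ρ := by
    ext p q
    have h : (Matrix.of fun x y => (z • ρ) (p.1, x) (q.1, y))
        = z • (Matrix.of fun x y => ρ (p.1, x) (q.1, y)) := by
      ext x y; simp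
    show M (Matrix.of fun x y => (z • ρ) (p.1, x) (q.1, y)) p.2 q.2 = _
    rw [h, map_smul]; rfl

/-- A quantum channel: trace preserving and completely positive. -/
def IsChannel (N : Matrix a a ℂ →ₗ[ℂ] Matrix b b ℂ) : Prop :=
  (∀ ρ : Matrix a a ℂ, Matrix.trace (N ρ) = Matrix.trace ρ) ∧
  ∀ (k : ℕ) (ρ : Matrix (a × Fin k) (a × Fin k) ℂ), ρ.PosSemidef →
    (tensorId N (Fin k) ρ).PosSemidef

/-- The maximally mixed state on system `b`. -/
def maxMixed (b : Type*) [Fintype b] [DecidableEq b] : Matrix b b ℂ :=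
  ((Fintype.card b : ℂ))⁻¹ • (1 : Matrix b b ℂ)

/-- The completely randomizing (depolarizing) channel. -/
def randomizing (a b : Type*) [Fintype a] [DecidableEq a] [Fintype b] [DecidableEq b] :
    Matrix a a ℂ →ₗ[ℂ] Matrix b b ℂ :=
  (Matrix.traceLinearMap a ℂ ℂ).smulRight (maxMixed b)

/-- The replacer channel `ρ ↦ Tr(ρ) σ`. -/
def replacer (a : Type*) [Fintype a] [DecidableEq a] (σ : Matrix b b ℂ) :
    Matrix a a ℂ →ₗ[ℂ] Matrix b b ℂ :=
  (Matrix.traceLinearMap a ℂ ℂ).smulRight σ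

/-- Channel (Umegaki) relative entropy: supremum over all finite reference systems. -/
def chRelEnt (N M : Matrix a a ℂ →ₗ[ℂ] Matrix b b ℂ) : ℝ :=
  ⨆ p : Σ k : ℕ, {ρ : Matrix (a × Fin k) (a × Fin k) ℂ // IsState ρ},
    relEnt (tensorId N (Fin p.1) p.2.1) (tensorId M (Fin p.1) p.2.1)

/-- Channel sandwiched Rényi relative entropy. -/
def chSandRenyi (α : ℝ) (N M : Matrix a a ℂ →ₗ[ℂ] Matrix b b ℂ) : ℝ :=
  ⨆ p : Σ k : ℕ, {ρ : Matrix (a × Fin k) (a × Fin k) ℂ // IsState ρ},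
    sandRenyi α (tensorId N (Fin p.1) p.2.1) (tensorId M (Fin p.1) p.2.1)

/-- Channel sandwiched Tsallis relative entropy. -/
def chSandTsallis (α : ℝ) (N M : Matrix a a ℂ →ₗ[ℂ] Matrix b b ℂ) : ℝ :=
  ⨆ p : Σ k : ℕ, {ρ : Matrix (a × Fin k) (a × Fin k) ℂ // IsState ρ},
    sandTsallis α (tensorId N (Fin p.1) p.2.1) (tensorId M (Fin p.1) p.2.1)

/-- Diamond distance between two maps. -/
def diamondDist (N M : Matrix a a ℂ →ₗ[ℂ] Matrix b b ℂ) : ℝ :=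
  ⨆ p : Σ k : ℕ, {ρ : Matrix (a × Fin k) (a × Fin k) ℂ // IsState ρ},
    traceNorm (tensorId N (Fin p.1) p.2.1 - tensorId M (Fin p.1) p.2.1)

/-- Entropy of a quantum channel. -/
def chEnt (N : Matrix a a ℂ →ₗ[ℂ] Matrix b b ℂ) : ℝ :=
  Real.logb 2 (Fintype.card b) - chRelEnt N (randomizing a b)

/-- α-Rényi entropy of a quantum channel. -/
def chRenyiEnt (α : ℝ) (N : Matrix a a ℂ →ₗ[ℂ] Matrix b b ℂ) : ℝ :=
  Real.logb 2 (Fintype.card b) - chSandRenyi α N (randomizing a b)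

/-- α-Tsallis entropy of a quantum channel. -/
def chTsallisEnt (α : ℝ) (N : Matrix a a ℂ →ₗ[ℂ] Matrix b b ℂ) : ℝ :=
  ((Fintype.card b : ℝ) ^ (1 - α) - 1) / (1 - α)
    - (Fintype.card b : ℝ) ^ (1 - α) * chSandTsallis α N (randomizing a b)


/-- Tensor product `N ⊗ M` of two maps on matrices. -/
def tensorChannel {a₁ b₁ a₂ b₂ : Type*} [Fintype a₁] [DecidableEq a₁] [Fintype b₁] [DecidableEq b₁]
    [Fintype a₂] [DecidableEq a₂] [Fintype b₂] [DecidableEq b₂]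
    (N : Matrix a₁ a₁ ℂ →ₗ[ℂ] Matrix b₁ b₁ ℂ) (M : Matrix a₂ a₂ ℂ →ₗ[ℂ] Matrix b₂ b₂ ℂ) :
    Matrix (a₁ × a₂) (a₁ × a₂) ℂ →ₗ[ℂ] Matrix (b₁ × b₂) (b₁ × b₂) ℂ :=
  (idTensor M b₁).comp (tensorId N a₂)


set_option linter.unusedSectionVars false

/-- `Tr A ^ α`. -/
def trp (α : ℝ) (A : Matrix n n ℂ) : ℝ := rtr (mpow A α)

theorem aeval_conj_diagonal {U : Matrix n n ℂ} (hU : star U * U = 1) (d : n → ℝ)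
    (p : Polynomial ℝ) :
    Polynomial.aeval (U * Matrix.diagonal (fun i => ((d i : ℝ) : ℂ)) * star U) p
      = U * Matrix.diagonal (fun i => ((p.eval (d i) : ℝ) : ℂ)) * star U := by
  have hU' : U * star U = 1 := mul_eq_one_comm.mp hU
  induction p using Polynomial.induction_on' with
  | add p q hp hq =>
    rw [map_add, hp, hq, ← add_mul, ← mul_add, Matrix.diagonal_add]
    simp
  | monomial k c =>
    have hpow : ∀ k : ℕ, (U * Matrix.diagonal (fun i => ((d i : ℝ) : ℂ)) * star U) ^ k
        = U * Matrix.diagonal (fun i => (((d i) ^ k : ℝ) : ℂ)) * star U := by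
      intro k
      induction k with
      | zero => simp [hU']
      | succ k ih =>
        rw [pow_succ, ih]
        calc _ = U * Matrix.diagonal (fun i => (((d i) ^ k : ℝ) : ℂ)) * (star U * U)
              * Matrix.diagonal (fun i => ((d i : ℝ) : ℂ)) * star U := by
              simp only [mul_assoc]
          _ = _ := by
              rw [hU, mul_one, mul_assoc U, Matrix.diagonal_mul_diagonal]
              simp [pow_succ]
    rw [Polynomial.aeval_monomial, hpow]
    simp only [Polynomial.eval_monomial]
    have : (Matrix.diagonal fun i => ((c * d i ^ k : ℝ) : ℂ))
        = c • (Matrix.diagonal fun i => ((d i ^ k : ℝ) : ℂ)) := by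
      ext i j
      by_cases h : i = j <;> simp [h]
    rw [this, Algebra.algebraMap_eq_smul_one]
    simp

theorem exists_polynomial_eval_eq (s : Finset ℝ) (f : ℝ → ℝ) :
    ∃ p : Polynomial ℝ, ∀ x ∈ s, p.eval x = f x :=
  ⟨Lagrange.interpolate s id f, fun _ hx =>
    Lagrange.eval_interpolate_at_node f (Set.injOn_id _) hx⟩

theorem isHermitian_conj_diagonal (U : Matrix n n ℂ) (d : n → ℝ) :
    (U * Matrix.diagonal (fun i => ((d i : ℝ) : ℂ)) * star U).IsHermitian := by
  rw [Matrix.star_eq_conjTranspose]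
  apply Matrix.isHermitian_mul_mul_conjTranspose
  rw [Matrix.isHermitian_diagonal_iff]
  intro i
  simp [isSelfAdjoint_iff]

theorem star_eigenvectorUnitary_mul {A : Matrix n n ℂ} (hA : A.IsHermitian) :
    star (hA.eigenvectorUnitary : Matrix n n ℂ) * (hA.eigenvectorUnitary : Matrix n n ℂ) = 1 :=
  Unitary.coe_star_mul_self _

theorem eq_conj_diagonal {A : Matrix n n ℂ} (hA : A.IsHermitian) :
    A = (hA.eigenvectorUnitary : Matrix n n ℂ) *
      Matrix.diagonal (fun i => ((hA.eigenvalues i : ℝ) : ℂ)) *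
      star (hA.eigenvectorUnitary : Matrix n n ℂ) := by
  conv_lhs => rw [hA.spectral_theorem]
  rfl

theorem mfun_eq_aeval {A : Matrix n n ℂ} (hA : A.IsHermitian) (f : ℝ → ℝ) (p : Polynomial ℝ)
    (h : ∀ i, p.eval (hA.eigenvalues i) = f (hA.eigenvalues i)) :
    mfun f A = Polynomial.aeval A p := by
  conv_rhs => rw [eq_conj_diagonal hA]
  rw [aeval_conj_diagonal (star_eigenvectorUnitary_mul hA)]
  simp only [mfun, hA, dif_pos, h]

theorem mfun_conj_diagonal {U : Matrix n n ℂ} (hU : star U * U = 1) (d : n → ℝ) (f : ℝ → ℝ) :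
    mfun f (U * Matrix.diagonal (fun i => ((d i : ℝ) : ℂ)) * star U)
      = U * Matrix.diagonal (fun i => ((f (d i) : ℝ) : ℂ)) * star U := by
  have hA := isHermitian_conj_diagonal U d
  obtain ⟨p, hp⟩ := exists_polynomial_eval_eq
    (Finset.univ.image d ∪ Finset.univ.image hA.eigenvalues) f
  rw [mfun_eq_aeval hA f p fun i => hp _ (by simp), aeval_conj_diagonal hU]
  have : ∀ i, p.eval (d i) = f (d i) := fun i => hp _ (by simp)
  simp only [this]

theorem exists_eq_conj_diagonal {A : Matrix n n ℂ} (hA : A.PosSemidef) :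
    ∃ (U : Matrix n n ℂ) (d : n → ℝ), star U * U = 1 ∧ (∀ i, 0 ≤ d i) ∧
      A = U * Matrix.diagonal (fun i => ((d i : ℝ) : ℂ)) * star U :=
  ⟨_, _, star_eigenvectorUnitary_mul hA.1, hA.eigenvalues_nonneg, eq_conj_diagonal hA.1⟩

theorem rtr_conj_diagonal {U : Matrix n n ℂ} (hU : star U * U = 1) (d : n → ℝ) :
    rtr (U * Matrix.diagonal (fun i => ((d i : ℝ) : ℂ)) * star U) = ∑ i, d i := by
  rw [rtr, Matrix.trace_mul_comm, ← mul_assoc, hU, one_mul, Matrix.trace_diagonal]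
  simp

theorem posSemidef_conj_diagonal (U : Matrix n n ℂ) {d : n → ℝ} (hd : ∀ i, 0 ≤ d i) :
    (U * Matrix.diagonal (fun i => ((d i : ℝ) : ℂ)) * star U).PosSemidef := by
  rw [Matrix.star_eq_conjTranspose]
  apply Matrix.PosSemidef.mul_mul_conjTranspose_same
  apply Matrix.PosSemidef.diagonal
  intro i
  simpa using hd i

theorem mpow_posSemidef {A : Matrix n n ℂ} (hA : A.PosSemidef) (p : ℝ) :
    (mpow A p).PosSemidef := by
  obtain ⟨U, d, hU, hd, rfl⟩ := exists_eq_conj_diagonal hA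
  rw [mpow, mfun_conj_diagonal hU]
  exact posSemidef_conj_diagonal U fun i => Real.rpow_nonneg (hd i) _

theorem mpow_mpow {A : Matrix n n ℂ} (hA : A.PosSemidef) (p q : ℝ) :
    mpow (mpow A p) q = mpow A (p * q) := by
  obtain ⟨U, d, hU, hd, rfl⟩ := exists_eq_conj_diagonal hA
  simp only [mpow]
  rw [mfun_conj_diagonal hU, mfun_conj_diagonal hU, mfun_conj_diagonal hU]
  simp only [Real.rpow_mul (hd _)]

theorem mpow_one {A : Matrix n n ℂ} (hA : A.PosSemidef) : mpow A 1 = A := by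
  obtain ⟨U, d, hU, hd, rfl⟩ := exists_eq_conj_diagonal hA
  rw [mpow, mfun_conj_diagonal hU]
  simp

theorem mpow_mul_mpow {A : Matrix n n ℂ} (hA : A.PosSemidef) {p q : ℝ} (hpq : p + q ≠ 0) :
    mpow A p * mpow A q = mpow A (p + q) := by
  obtain ⟨U, d, hU, hd, rfl⟩ := exists_eq_conj_diagonal hA
  simp only [mpow]
  rw [mfun_conj_diagonal hU, mfun_conj_diagonal hU, mfun_conj_diagonal hU]
  calc _ = U * Matrix.diagonal (fun i => ((d i ^ p : ℝ) : ℂ)) * (star U * U)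
        * Matrix.diagonal (fun i => ((d i ^ q : ℝ) : ℂ)) * star U := by
        simp only [mul_assoc]
    _ = _ := by
        rw [hU, mul_one, mul_assoc U, Matrix.diagonal_mul_diagonal]
        simp only [Real.rpow_add' (hd _) hpq, Complex.ofReal_mul]

theorem trp_conj_diagonal {U : Matrix n n ℂ} (hU : star U * U = 1) (d : n → ℝ) (α : ℝ) :
    trp α (U * Matrix.diagonal (fun i => ((d i : ℝ) : ℂ)) * star U) = ∑ i, d i ^ α := by
  rw [trp, mpow, mfun_conj_diagonal hU, rtr_conj_diagonal hU]

theorem trp_nonneg {A : Matrix n n ℂ} (hA : A.PosSemidef) (α : ℝ) : 0 ≤ trp α A := by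
  obtain ⟨U, d, hU, hd, rfl⟩ := exists_eq_conj_diagonal hA
  rw [trp_conj_diagonal hU]
  exact Finset.sum_nonneg fun i _ => Real.rpow_nonneg (hd i) _

theorem smul_conj_diagonal (U : Matrix n n ℂ) (d : n → ℝ) (c : ℝ) :
    (c : ℂ) • (U * Matrix.diagonal (fun i => ((d i : ℝ) : ℂ)) * star U)
      = U * Matrix.diagonal (fun i => ((c * d i : ℝ) : ℂ)) * star U := by
  have : (Matrix.diagonal fun i => ((c * d i : ℝ) : ℂ))
      = (c : ℂ) • (Matrix.diagonal fun i => ((d i : ℝ) : ℂ)) := by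
    ext i j
    by_cases h : i = j <;> simp [h]
  rw [this]
  simp

theorem mpow_smul {A : Matrix n n ℂ} (hA : A.PosSemidef) {c : ℝ} (hc : 0 ≤ c) (p : ℝ) :
    mpow ((c : ℂ) • A) p = ((c ^ p : ℝ) : ℂ) • mpow A p := by
  obtain ⟨U, d, hU, hd, rfl⟩ := exists_eq_conj_diagonal hA
  rw [smul_conj_diagonal, mpow, mpow, mfun_conj_diagonal hU, mfun_conj_diagonal hU,
    smul_conj_diagonal]
  simp only [Real.mul_rpow hc (hd _)]

theorem rtr_smul (c : ℝ) (A : Matrix n n ℂ) : rtr ((c : ℂ) • A) = c * rtr A := by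
  simp [rtr, Matrix.trace_smul]

theorem trp_smul {A : Matrix n n ℂ} (hA : A.PosSemidef) {c : ℝ} (hc : 0 ≤ c) (p : ℝ) :
    trp p ((c : ℂ) • A) = c ^ p * trp p A := by
  rw [trp, mpow_smul hA hc, rtr_smul, trp]

theorem kronecker_conj_diagonal {m : Type*} [Fintype m] [DecidableEq m]
    (U : Matrix n n ℂ) (V : Matrix m m ℂ) (d : n → ℝ) (e : m → ℝ) :
    (U * Matrix.diagonal (fun i => ((d i : ℝ) : ℂ)) * star U) ⊗ₖ
        (V * Matrix.diagonal (fun i => ((e i : ℝ) : ℂ)) * star V)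
      = (U ⊗ₖ V) * Matrix.diagonal (fun i : n × m => ((d i.1 * e i.2 : ℝ) : ℂ))
        * star (U ⊗ₖ V) := by
  rw [Matrix.mul_kronecker_mul, Matrix.mul_kronecker_mul, Matrix.diagonal_kronecker_diagonal]
  simp [Matrix.star_eq_conjTranspose, Matrix.conjTranspose_kronecker]

theorem star_kronecker_mul_self {m : Type*} [Fintype m] [DecidableEq m]
    {U : Matrix n n ℂ} {V : Matrix m m ℂ} (hU : star U * U = 1) (hV : star V * V = 1) :
    star (U ⊗ₖ V) * (U ⊗ₖ V) = 1 := by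
  rw [Matrix.star_eq_conjTranspose] at *
  rw [Matrix.conjTranspose_kronecker, ← Matrix.mul_kronecker_mul, hU, hV,
    Matrix.one_kronecker_one]

theorem mpow_kronecker {m : Type*} [Fintype m] [DecidableEq m]
    {A : Matrix n n ℂ} {B : Matrix m m ℂ} (hA : A.PosSemidef) (hB : B.PosSemidef) (p : ℝ) :
    mpow (A ⊗ₖ B) p = mpow A p ⊗ₖ mpow B p := by
  obtain ⟨U, d, hU, hd, rfl⟩ := exists_eq_conj_diagonal hA
  obtain ⟨V, e, hV, he, rfl⟩ := exists_eq_conj_diagonal hB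
  rw [kronecker_conj_diagonal, mpow, mpow, mpow,
    mfun_conj_diagonal (star_kronecker_mul_self hU hV), mfun_conj_diagonal hU,
    mfun_conj_diagonal hV, kronecker_conj_diagonal]
  simp only [Real.mul_rpow (hd _) (he _)]

theorem trp_kronecker {m : Type*} [Fintype m] [DecidableEq m]
    {A : Matrix n n ℂ} {B : Matrix m m ℂ} (hA : A.PosSemidef) (hB : B.PosSemidef) (p : ℝ) :
    trp p (A ⊗ₖ B) = trp p A * trp p B := by
  obtain ⟨U, d, hU, hd, rfl⟩ := exists_eq_conj_diagonal hA
  obtain ⟨V, e, hV, he, rfl⟩ := exists_eq_conj_diagonal hB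
  rw [kronecker_conj_diagonal, trp_conj_diagonal (star_kronecker_mul_self hU hV),
    trp_conj_diagonal hU, trp_conj_diagonal hV, Fintype.sum_prod_type, Finset.sum_mul_sum]
  simp only [Real.mul_rpow (hd _) (he _)]

theorem mpow_one_matrix (p : ℝ) : mpow (1 : Matrix n n ℂ) p = 1 := by
  have := mfun_conj_diagonal (U := (1 : Matrix n n ℂ)) (by simp) (fun _ => 1) (fun x => x ^ p)
  simpa [mpow] using this

theorem trp_one (p : ℝ) : trp p (1 : Matrix n n ℂ) = Fintype.card n := by
  rw [trp, mpow_one_matrix, rtr, Matrix.trace_one]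
  simp

theorem trp_submatrix {m : Type*} [Fintype m] [DecidableEq m] {A : Matrix n n ℂ}
    (hA : A.PosSemidef) (e : m ≃ n) (p : ℝ) : trp p (A.submatrix e e) = trp p A := by
  obtain ⟨U, d, hU, hd, rfl⟩ := exists_eq_conj_diagonal hA
  have h : (U * Matrix.diagonal (fun i => ((d i : ℝ) : ℂ)) * star U).submatrix e e
      = U.submatrix e e * Matrix.diagonal (fun i => ((d (e i) : ℝ) : ℂ))
        * star (U.submatrix e e) := by
    rw [Matrix.star_eq_conjTranspose, Matrix.star_eq_conjTranspose, Matrix.conjTranspose_submatrix,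
      ← Matrix.submatrix_mul_equiv _ _ _ e, ← Matrix.submatrix_mul_equiv _ _ _ e,
      Matrix.submatrix_diagonal_equiv]
    rfl
  have hU' : star (U.submatrix e e) * U.submatrix e e = 1 := by
    rw [Matrix.star_eq_conjTranspose, Matrix.conjTranspose_submatrix,
      Matrix.submatrix_mul_equiv, ← Matrix.star_eq_conjTranspose, hU,
      Matrix.submatrix_one_equiv]
  rw [h, trp_conj_diagonal hU', trp_conj_diagonal hU]
  exact Equiv.sum_comp e fun i => d i ^ p

theorem aeval_conjTranspose_mul_intertwine {m : Type*} [Fintype m] [DecidableEq m]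
    (Y : Matrix m n ℂ) (p : Polynomial ℝ) :
    Y.conjTranspose * Polynomial.aeval (Y * Y.conjTranspose) p
      = Polynomial.aeval (Y.conjTranspose * Y) p * Y.conjTranspose := by
  induction p using Polynomial.induction_on' with
  | add p q hp hq => rw [map_add, map_add, Matrix.mul_add, hp, hq, Matrix.add_mul]
  | monomial k c =>
    have hpow : Y.conjTranspose * (Y * Y.conjTranspose) ^ k
        = (Y.conjTranspose * Y) ^ k * Y.conjTranspose := by
      induction k with
      | zero => simp
      | succ k ih =>
        rw [pow_succ, ← Matrix.mul_assoc, ih, pow_succ]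
        simp only [Matrix.mul_assoc]
    rw [Polynomial.aeval_monomial, Polynomial.aeval_monomial, Algebra.algebraMap_eq_smul_one,
      Algebra.algebraMap_eq_smul_one]
    simp [hpow]

theorem conjTranspose_mul_mfun {m : Type*} [Fintype m] [DecidableEq m]
    (Y : Matrix m n ℂ) (f : ℝ → ℝ) :
    Y.conjTranspose * mfun f (Y * Y.conjTranspose)
      = mfun f (Y.conjTranspose * Y) * Y.conjTranspose := by
  have h1 := Matrix.isHermitian_mul_conjTranspose_self Y
  have h2 := Matrix.isHermitian_conjTranspose_mul_self Y
  obtain ⟨p, hp⟩ := exists_polynomial_eval_eq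
    (Finset.univ.image h1.eigenvalues ∪ Finset.univ.image h2.eigenvalues) f
  rw [mfun_eq_aeval h1 f p fun i => hp _ (by simp), mfun_eq_aeval h2 f p fun i => hp _ (by simp),
    aeval_conjTranspose_mul_intertwine]

theorem conjTranspose_mul_mpow_mul {m : Type*} [Fintype m] [DecidableEq m]
    (Y : Matrix m n ℂ) {p : ℝ} (hp : p ≠ 0) :
    Y.conjTranspose * mpow (Y * Y.conjTranspose) (p - 1) * Y
      = mpow (Y.conjTranspose * Y) p := by
  have hY := Matrix.posSemidef_conjTranspose_mul_self Y
  have := mpow_mul_mpow hY (p := p - 1) (q := 1) (by simpa using hp)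
  rw [mpow_one hY, sub_add_cancel] at this
  rw [mpow, conjTranspose_mul_mfun, Matrix.mul_assoc, ← this, mpow]

theorem trp_conjTranspose_mul_self {m : Type*} [Fintype m] [DecidableEq m]
    (Y : Matrix m n ℂ) {p : ℝ} (hp : p ≠ 0) :
    trp p (Y.conjTranspose * Y) = trp p (Y * Y.conjTranspose) := by
  have hY := Matrix.posSemidef_self_mul_conjTranspose Y
  have := mpow_mul_mpow hY (p := 1) (q := p - 1) (by simpa using hp)
  rw [mpow_one hY, add_sub_cancel] at this
  rw [trp, trp, ← conjTranspose_mul_mpow_mul Y hp, ← this, rtr, rtr, Matrix.trace_mul_comm,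
    ← Matrix.mul_assoc]

/-- The matrix `∑ₑ Lₑ ⊗ 1_C` sending `e ⊗ c` to the vectorization of `Lₑ` tensored with `c`. -/
def krausMat {A B E : Type*} (L : E → Matrix B A ℂ) (C : Type*) [DecidableEq C] :
    Matrix (B × (A × C)) (E × C) ℂ :=
  Matrix.of fun p q => if p.2.2 = q.2 then L q.1 p.1 p.2.1 else 0

/-- The (transposed) complementary map of the map with Kraus operators `L`, extended by the
identity on `C`. -/
def complMap {A B E C : Type*} [Fintype A] [Fintype B] [DecidableEq B] [Fintype C] [DecidableEq C]
    (L : E → Matrix B A ℂ) (X : Matrix (A × C) (A × C) ℂ) : Matrix (E × C) (E × C) ℂ :=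
  (krausMat L C).conjTranspose * ((1 : Matrix B B ℂ) ⊗ₖ X) * krausMat L C

section Complement

variable {A B E C R : Type*} [Fintype A] [DecidableEq A] [Fintype B] [DecidableEq B]
  [Fintype E] [DecidableEq E] [Fintype C] [DecidableEq C] [Fintype R] [DecidableEq R]

theorem complMap_apply (L : E → Matrix B A ℂ) (X : Matrix (A × C) (A × C) ℂ) (p q : E × C) :
    complMap L X p q
      = ∑ b, ∑ x, ∑ y, star (L p.1 b x) * X (x, p.2) (y, q.2) * L q.1 b y := by
  obtain ⟨e, c⟩ := p
  obtain ⟨e', c'⟩ := q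
  simp only [complMap, Matrix.mul_apply, krausMat, Matrix.conjTranspose_apply, Matrix.of_apply,
    Matrix.kronecker_apply, Fintype.sum_prod_type, Matrix.one_apply, apply_ite star, star_zero,
    ite_mul, mul_ite, zero_mul, mul_zero, one_mul, Finset.sum_ite_eq',
    Finset.sum_mul, Finset.mem_univ, if_true]
  simp [Finset.sum_ite_irrel]
  refine Finset.sum_congr rfl fun b _ => ?_
  rw [Finset.sum_comm]

theorem complMap_posSemidef (L : E → Matrix B A ℂ) {X : Matrix (A × C) (A × C) ℂ}
    (hX : X.PosSemidef) : (complMap L X).PosSemidef :=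
  (Matrix.PosSemidef.one.kronecker hX).conjTranspose_mul_mul_same _

theorem complMap_smul (L : E → Matrix B A ℂ) (c : ℂ) (X : Matrix (A × C) (A × C) ℂ) :
    complMap L (c • X) = c • complMap L X := by
  simp [complMap, Matrix.kronecker_smul]

/-- `L` is a family of Kraus operators of `N`. -/
def IsKraus (N : Matrix A A ℂ →ₗ[ℂ] Matrix B B ℂ) (L : E → Matrix B A ℂ) : Prop :=
  ∀ X i j, N X i j = ∑ e, ∑ x, ∑ y, L e i x * X x y * star (L e j y)

/-- The matrix `Tr_C |Ψ⟩⟨Ψ|` on `A ⊗ R`, for a vector `Ψ` in `R ⊗ (A ⊗ C)`. -/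
def reduced (Ψ : Matrix R (A × C) ℂ) : Matrix (A × R) (A × R) ℂ :=
  Matrix.of fun p q => ∑ c, Ψ p.2 (p.1, c) * star (Ψ q.2 (q.1, c))

theorem tensorId_reduced {N : Matrix A A ℂ →ₗ[ℂ] Matrix B B ℂ} {L : E → Matrix B A ℂ}
    (hL : IsKraus N L) (Ψ : Matrix R (A × C) ℂ) :
    tensorId N R (reduced Ψ)
      = (((1 : Matrix B B ℂ) ⊗ₖ Ψ) * krausMat L C)
        * (((1 : Matrix B B ℂ) ⊗ₖ Ψ) * krausMat L C).conjTranspose := by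
  have hY : ∀ b r e c, (((1 : Matrix B B ℂ) ⊗ₖ Ψ) * krausMat L C) (b, r) (e, c)
      = ∑ x, L e b x * Ψ r (x, c) := by
    intro b r e c
    simp [Matrix.mul_apply, krausMat, Fintype.sum_prod_type, Matrix.one_apply,
      Finset.sum_ite_irrel, mul_comm]
  ext ⟨b, r⟩ ⟨b', r'⟩
  change N _ b b' = _
  rw [hL, Matrix.mul_apply, Fintype.sum_prod_type]
  refine Finset.sum_congr rfl fun e _ => ?_
  simp only [Matrix.conjTranspose_apply, hY, reduced, Matrix.of_apply, star_sum, star_mul',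
    Finset.sum_mul, Finset.mul_sum]
  conv_rhs => rw [Finset.sum_comm]; enter [2, x]; rw [Finset.sum_comm]
  conv_rhs => rw [Finset.sum_comm]
  refine Finset.sum_congr rfl fun x _ => Finset.sum_congr rfl fun y _ =>
    Finset.sum_congr rfl fun z _ => ?_
  ring

theorem tensorId_randomizing_reduced (Ψ : Matrix R (A × C) ℂ) :
    tensorId (randomizing A B) R (reduced Ψ)
      = (((Fintype.card B : ℝ)⁻¹ : ℝ) : ℂ) • ((1 : Matrix B B ℂ) ⊗ₖ (Ψ * Ψ.conjTranspose)) := by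
  ext ⟨b, r⟩ ⟨b', r'⟩
  change (randomizing A B) _ b b' = _
  simp only [randomizing, LinearMap.smulRight_apply, Matrix.traceLinearMap_apply, maxMixed,
    Matrix.trace, Matrix.diag, Matrix.of_apply, reduced, Matrix.smul_apply, Matrix.kronecker_apply,
    Matrix.mul_apply, Matrix.conjTranspose_apply, Fintype.sum_prod_type, smul_eq_mul]
  push_cast
  ring

theorem sandTr_reduced {N : Matrix A A ℂ →ₗ[ℂ] Matrix B B ℂ} {L : E → Matrix B A ℂ}
    (hL : IsKraus N L) (Ψ : Matrix R (A × C) ℂ) {α : ℝ} (hα : 0 < α) (hα1 : α ≠ 1) :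
    sandTr α (tensorId N R (reduced Ψ)) (tensorId (randomizing A B) R (reduced Ψ))
      = (Fintype.card B : ℝ) ^ (α - 1)
        * trp α (complMap L (mpow (Ψ.conjTranspose * Ψ) α⁻¹)) := by
  have hα0 := hα.ne'
  set γ := (1 - α) / (2 * α) with hγ
  have hγ2 : γ + γ = α⁻¹ - 1 := by rw [hγ]; field_simp; ring
  have hγ0 : γ + γ ≠ 0 := by
    rw [hγ2, sub_ne_zero]
    exact fun h => hα1 (by simpa using h)
  have hΨ := Matrix.posSemidef_self_mul_conjTranspose Ψ
  set G := mpow (Ψ * Ψ.conjTranspose) γ with hG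
  have hGG : G * G = mpow (Ψ * Ψ.conjTranspose) (α⁻¹ - 1) := by
    rw [hG, mpow_mul_mpow hΨ hγ0, hγ2]
  have hGh : G.conjTranspose = G := (mpow_posSemidef hΨ γ).1
  set Y := ((1 : Matrix B B ℂ) ⊗ₖ Ψ) * krausMat L C with hY
  set c : ℝ := ((Fintype.card B : ℝ)⁻¹) ^ γ with hc
  have hc0 : 0 ≤ c := by positivity
  have hcc : (c * c) ^ α = (Fintype.card B : ℝ) ^ (α - 1) := by
    rw [hc, ← Real.rpow_add' (by positivity) hγ0, ← Real.rpow_mul (by positivity),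
      Real.inv_rpow (by positivity), ← Real.rpow_neg (by positivity), hγ2]
    congr 1
    field_simp
    ring
  rw [sandTr, tensorId_reduced hL, tensorId_randomizing_reduced,
    mpow_smul (Matrix.PosSemidef.one.kronecker hΨ) (by positivity),
    mpow_kronecker Matrix.PosSemidef.one hΨ, mpow_one_matrix, ← hG, ← hY, ← hc]
  set Z := ((1 : Matrix B B ℂ) ⊗ₖ G) * Y with hZ
  have hmul : ((c : ℂ) • ((1 : Matrix B B ℂ) ⊗ₖ G)) * (Y * Y.conjTranspose)
      * ((c : ℂ) • ((1 : Matrix B B ℂ) ⊗ₖ G)) = ((c * c : ℝ) : ℂ) • (Z * Z.conjTranspose) := by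
    rw [hZ, Matrix.conjTranspose_mul _ Y, Matrix.conjTranspose_kronecker _ G, hGh,
      Matrix.conjTranspose_one]
    simp only [Matrix.smul_mul, Matrix.mul_smul, smul_smul, Matrix.mul_assoc]
    push_cast
    rfl
  have hZZ : Z.conjTranspose * Z = complMap L (mpow (Ψ.conjTranspose * Ψ) α⁻¹) := by
    rw [← conjTranspose_mul_mpow_mul Ψ (inv_ne_zero hα0), ← hGG, complMap, hZ, hY,
      Matrix.conjTranspose_mul, Matrix.conjTranspose_mul, Matrix.conjTranspose_kronecker,
      Matrix.conjTranspose_kronecker, hGh, Matrix.conjTranspose_one]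
    have h1 : (1 : Matrix B B ℂ) ⊗ₖ (Ψ.conjTranspose * (G * G) * Ψ)
        = ((1 : Matrix B B ℂ) ⊗ₖ Ψ.conjTranspose) * ((1 : Matrix B B ℂ) ⊗ₖ G)
          * (((1 : Matrix B B ℂ) ⊗ₖ G) * ((1 : Matrix B B ℂ) ⊗ₖ Ψ)) := by
      simp only [← Matrix.mul_kronecker_mul, one_mul, Matrix.mul_assoc]
    rw [h1]
    simp only [Matrix.mul_assoc]
  rw [hmul, ← trp, trp_smul (Matrix.posSemidef_self_mul_conjTranspose Z) (by positivity), hcc,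
    ← trp_conjTranspose_mul_self Z hα0, hZZ]

end Complement

theorem rtr_mul_nonneg {A B : Matrix n n ℂ} (hA : A.PosSemidef) (hB : B.PosSemidef) :
    0 ≤ rtr (A * B) := by
  have hs := mpow_posSemidef hA 2⁻¹
  have hA2 : A = mpow A 2⁻¹ * mpow A 2⁻¹ := by
    rw [mpow_mul_mpow hA (by norm_num)]
    norm_num [mpow_one hA]
  have h := (hB.mul_mul_conjTranspose_same (mpow A 2⁻¹)).trace_nonneg
  rw [hs.1, Matrix.trace_mul_comm, ← Matrix.mul_assoc, ← hA2] at h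
  exact (Complex.nonneg_iff.mp h).1

theorem sum_normSq_row {W : Matrix n n ℂ} (hW : W * star W = 1) (i : n) :
    ∑ j, Complex.normSq (W i j) = 1 := by
  have h := congrFun (congrFun hW i) i
  rw [Matrix.mul_apply, Matrix.one_apply_eq] at h
  simp only [Matrix.star_apply, Complex.star_def, Complex.mul_conj] at h
  exact_mod_cast h

theorem rtr_mul_conj_diagonal {U V : Matrix n n ℂ} (a b : n → ℝ) :
    rtr ((U * Matrix.diagonal (fun i => ((a i : ℝ) : ℂ)) * star U) *
        (V * Matrix.diagonal (fun i => ((b i : ℝ) : ℂ)) * star V))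
      = ∑ i, ∑ j, a i * b j * Complex.normSq ((star U * V) i j) := by
  set W := star U * V with hW
  have h1 : Matrix.trace ((U * Matrix.diagonal (fun i => ((a i : ℝ) : ℂ)) * star U) *
        (V * Matrix.diagonal (fun i => ((b i : ℝ) : ℂ)) * star V))
      = Matrix.trace ((Matrix.diagonal (fun i => ((a i : ℝ) : ℂ)) * W)
        * (Matrix.diagonal (fun i => ((b i : ℝ) : ℂ)) * star W)) := by
    rw [hW, star_mul, star_star]
    simp only [Matrix.mul_assoc]
    rw [Matrix.trace_mul_comm]
    simp only [Matrix.mul_assoc]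
  rw [rtr, h1, Matrix.trace, Complex.re_sum]
  refine Finset.sum_congr rfl fun i _ => ?_
  rw [Matrix.diag_apply, Matrix.mul_apply, Complex.re_sum]
  refine Finset.sum_congr rfl fun j _ => ?_
  rw [Matrix.diagonal_mul, Matrix.diagonal_mul, Matrix.star_apply, Complex.star_def]
  have : (a i : ℂ) * W i j * ((b j : ℂ) * (starRingEnd ℂ) (W i j))
      = ((a i * b j * Complex.normSq (W i j) : ℝ) : ℂ) := by
    push_cast
    rw [← Complex.mul_conj]
    ring
  rw [this, Complex.ofReal_re]

/-- Young's inequality for traces. -/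
theorem rtr_mpow_mul_le {A B : Matrix n n ℂ} (hA : A.PosSemidef) (hB : B.PosSemidef) {α : ℝ}
    (hα : 1 < α) :
    rtr (mpow A (α - 1) * B) ≤ (1 - α⁻¹) * trp α A + α⁻¹ * trp α B := by
  obtain ⟨U, a, hU, ha, rfl⟩ := exists_eq_conj_diagonal hA
  obtain ⟨V, b, hV, hb, rfl⟩ := exists_eq_conj_diagonal hB
  rw [trp_conj_diagonal hU, trp_conj_diagonal hV, mpow, mfun_conj_diagonal hU,
    rtr_mul_conj_diagonal]
  set W := star U * V with hW
  have hU' : U * star U = 1 := mul_eq_one_comm.mp hU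
  have hV' : V * star V = 1 := mul_eq_one_comm.mp hV
  have hWW : W * star W = 1 := by
    rw [hW, star_mul, star_star, mul_assoc, ← mul_assoc V, hV', one_mul, hU]
  have hWW' : star W * star (star W) = 1 := by
    rw [star_star]; exact mul_eq_one_comm.mp hWW
  have hcol : ∀ j, ∑ i, Complex.normSq (W i j) = 1 := by
    intro j
    simpa [Matrix.star_apply, Complex.normSq_conj] using sum_normSq_row hWW' j
  have hα0 : 0 < α := by linarith
  have hyoung : ∀ i j, a i ^ (α - 1) * b j ≤ (1 - α⁻¹) * a i ^ α + α⁻¹ * b j ^ α := by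
    intro i j
    have hconj : (α / (α - 1)).HolderConjugate α := by
      have := Real.HolderConjugate.conjExponent hα
      exact this.symm
    have h := Real.young_inequality_of_nonneg (Real.rpow_nonneg (ha i) (α - 1)) (hb j) hconj
    have hα1 : α - 1 ≠ 0 := by linarith
    rw [← Real.rpow_mul (ha i), mul_div_cancel₀ _ hα1] at h
    refine h.trans_eq ?_
    field_simp
  calc ∑ i, ∑ j, a i ^ (α - 1) * b j * Complex.normSq (W i j)
      ≤ ∑ i, ∑ j, ((1 - α⁻¹) * a i ^ α + α⁻¹ * b j ^ α) * Complex.normSq (W i j) :=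
        Finset.sum_le_sum fun i _ => Finset.sum_le_sum fun j _ =>
          mul_le_mul_of_nonneg_right (hyoung i j) (Complex.normSq_nonneg _)
    _ = (1 - α⁻¹) * ∑ i, a i ^ α * ∑ j, Complex.normSq (W i j)
        + α⁻¹ * ∑ j, b j ^ α * ∑ i, Complex.normSq (W i j) := by
        simp only [add_mul, Finset.sum_add_distrib, Finset.mul_sum, mul_assoc]
        congr 1
        exact Finset.sum_comm
    _ = _ := by simp only [sum_normSq_row hWW, hcol, mul_one]

theorem trp_mono {A B : Matrix n n ℂ} (hA : A.PosSemidef) (hB : B.PosSemidef)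
    (hAB : (B - A).PosSemidef) {α : ℝ} (hα : 1 < α) : trp α A ≤ trp α B := by
  have h1 := rtr_mul_nonneg (mpow_posSemidef hA (α - 1)) hAB
  have h2 := rtr_mpow_mul_le hA hB hα
  have h3 : rtr (mpow A (α - 1) * A) = trp α A := by
    conv_lhs => enter [1, 2]; rw [← mpow_one hA]
    rw [mpow_mul_mpow hA (by linarith), sub_add_cancel, trp]
  rw [Matrix.mul_sub, rtr, Matrix.trace_sub, Complex.sub_re, ← rtr, ← rtr, h3] at h1
  have h4 : 0 < α⁻¹ := by positivity
  have h5 : α⁻¹ * trp α A ≤ α⁻¹ * trp α B := by linarith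
  exact le_of_mul_le_mul_left h5 h4

theorem posSemidef_trace_smul_one_sub {A : Matrix n n ℂ} (hA : A.PosSemidef) :
    (((rtr A : ℝ) : ℂ) • (1 : Matrix n n ℂ) - A).PosSemidef := by
  obtain ⟨U, d, hU, hd, rfl⟩ := exists_eq_conj_diagonal hA
  have hU' : U * star U = 1 := mul_eq_one_comm.mp hU
  rw [rtr_conj_diagonal hU]
  have : (((∑ i, d i : ℝ) : ℂ) • (1 : Matrix n n ℂ)
        - U * Matrix.diagonal (fun i => ((d i : ℝ) : ℂ)) * star U)
      = U * Matrix.diagonal (fun j => ((∑ i, d i - d j : ℝ) : ℂ)) * star U := by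
    have h : (Matrix.diagonal (fun j => ((∑ i, d i - d j : ℝ) : ℂ)))
        = ((∑ i, d i : ℝ) : ℂ) • (1 : Matrix n n ℂ)
          - Matrix.diagonal (fun i => ((d i : ℝ) : ℂ)) := by
      rw [← Matrix.diagonal_one, ← Matrix.diagonal_smul, Matrix.diagonal_sub]
      congr 1
      ext j
      simp
    rw [h, Matrix.mul_sub, Matrix.sub_mul]
    simp [hU']
  rw [this]
  exact posSemidef_conj_diagonal U fun j =>
    sub_nonneg.mpr (Finset.single_le_sum (fun i _ => hd i) (Finset.mem_univ j))

section Bound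

variable {A B E : Type*} [Fintype A] [DecidableEq A] [Fintype B] [DecidableEq B]
  [Fintype E] [DecidableEq E]

theorem exists_krausMat_bound (L : E → Matrix B A ℂ) :
    ∃ κ : ℝ, 0 ≤ κ ∧ ∀ (C : Type) [Fintype C] [DecidableEq C],
      ((κ : ℂ) • (1 : Matrix (B × (A × C)) (B × (A × C)) ℂ)
        - krausMat L C * (krausMat L C).conjTranspose).PosSemidef := by
  set k : Matrix (B × A) E ℂ := Matrix.of fun p e => L e p.1 p.2 with hk
  have hkk := Matrix.posSemidef_self_mul_conjTranspose k
  refine ⟨rtr (k * k.conjTranspose), (Complex.nonneg_iff.mp hkk.trace_nonneg).1, ?_⟩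
  intro C _ _
  have h := (posSemidef_trace_smul_one_sub hkk).kronecker
    (Matrix.PosSemidef.one : (1 : Matrix C C ℂ).PosSemidef)
  have h2 := h.submatrix (Equiv.prodAssoc B A C).symm
  have heq : ((rtr (k * k.conjTranspose) : ℝ) : ℂ) • (1 : Matrix (B × (A × C)) (B × (A × C)) ℂ)
        - krausMat L C * (krausMat L C).conjTranspose
      = ((((rtr (k * k.conjTranspose) : ℝ) : ℂ) • (1 : Matrix (B × A) (B × A) ℂ)
          - k * k.conjTranspose) ⊗ₖ (1 : Matrix C C ℂ)).submatrix (Equiv.prodAssoc B A C).symm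
            (Equiv.prodAssoc B A C).symm := by
    ext ⟨b, a, c⟩ ⟨b', a', c'⟩
    by_cases hc : c = c'
    · subst hc
      simp [krausMat, Matrix.mul_apply, Fintype.sum_prod_type, hk, Matrix.one_apply]
    · simp [krausMat, Matrix.mul_apply, Fintype.sum_prod_type, hk, Matrix.one_apply, hc,
        Ne.symm hc]
  rw [heq]
  exact h2

theorem exists_trp_complMap_le (L : E → Matrix B A ℂ) {α : ℝ} (hα : 1 < α) :
    ∃ κ : ℝ, ∀ (C : Type) [Fintype C] [DecidableEq C] (X : Matrix (A × C) (A × C) ℂ),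
      X.PosSemidef → trp α (complMap L X) ≤ κ * trp α X := by
  obtain ⟨κ, hκ, h⟩ := exists_krausMat_bound L
  refine ⟨κ ^ α * Fintype.card B, ?_⟩
  intro C _ _ X hX
  have hα0 : α ≠ 0 := by linarith
  set K := krausMat L C with hK
  set Z := (1 : Matrix B B ℂ) ⊗ₖ X with hZ
  have hZp : Z.PosSemidef := Matrix.PosSemidef.one.kronecker hX
  set S := mpow Z 2⁻¹ with hS
  have hSh : S.conjTranspose = S := (mpow_posSemidef hZp _).1
  have hSS : S * S = Z := by
    rw [hS, mpow_mul_mpow hZp (by norm_num)]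
    norm_num [mpow_one hZp]
  have h1 : complMap L X = (S * K).conjTranspose * (S * K) := by
    rw [complMap, ← hZ, ← hSS, Matrix.conjTranspose_mul S, hSh]
    simp only [Matrix.mul_assoc, hK]
  rw [h1, trp_conjTranspose_mul_self _ hα0]
  have h2 : ((κ : ℂ) • Z - (S * K) * (S * K).conjTranspose).PosSemidef := by
    have := (h C).mul_mul_conjTranspose_same S
    rw [hSh, Matrix.mul_sub, Matrix.sub_mul, Matrix.mul_smul, Matrix.smul_mul, mul_one,
      hSS] at this
    rw [Matrix.conjTranspose_mul S, hSh]
    simpa only [Matrix.mul_assoc] using this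
  have hκZ : ((κ : ℂ) • Z).PosSemidef := hZp.smul (by exact_mod_cast hκ)
  refine (trp_mono (Matrix.posSemidef_self_mul_conjTranspose _) hκZ h2 hα).trans_eq ?_
  rw [trp_smul hZp hκ, hZ, trp_kronecker Matrix.PosSemidef.one hX, trp_one, mul_assoc]

end Bound

section Kraus

variable {A B E : Type*} [Fintype A] [DecidableEq A] [Fintype B] [DecidableEq B]
  [Fintype E] [DecidableEq E]

theorem choi_posSemidef {N : Matrix A A ℂ →ₗ[ℂ] Matrix B B ℂ} (hN : IsChannel N) :
    (Matrix.of fun p q : B × A => N (Matrix.single p.2 q.2 1) p.1 q.1).PosSemidef := by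
  set σ := Fintype.equivFin A
  set w : A × Fin (Fintype.card A) → ℂ := fun p => if σ p.1 = p.2 then 1 else 0 with hw
  have h := (hN.2 _ _ (Matrix.posSemidef_vecMulVec_self_star w)).submatrix (Prod.map id σ)
  have heq : (Matrix.of fun p q : B × A => N (Matrix.single p.2 q.2 1) p.1 q.1)
      = (tensorId N _ (Matrix.vecMulVec w (star w))).submatrix (Prod.map id σ)
          (Prod.map id σ) := by
    ext ⟨b, x⟩ ⟨b', y⟩
    change _ = N _ b b'
    rw [Matrix.of_apply]
    refine congrArg (fun Y => N Y b b') ?_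
    ext x' y'
    by_cases hx : x = x' <;> by_cases hy : y = y' <;>
      simp [Matrix.vecMulVec_apply, hw, hx, hy, eq_comm]
  rw [heq]
  exact h

theorem exists_isKraus {N : Matrix A A ℂ →ₗ[ℂ] Matrix B B ℂ} (hN : IsChannel N) :
    ∃ L : B × A → Matrix B A ℂ, IsKraus N L := by
  have hJ := choi_posSemidef hN
  set J := Matrix.of fun p q : B × A => N (Matrix.single p.2 q.2 1) p.1 q.1 with hJdef
  set Z := mpow J 2⁻¹ with hZ
  have hZh : Z.conjTranspose = Z := (mpow_posSemidef hJ _).1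
  have hZZ : J = Z * Z.conjTranspose := by
    rw [hZh, hZ, mpow_mul_mpow hJ (by norm_num)]
    norm_num [mpow_one hJ]
  refine ⟨fun e => Matrix.of fun i x => Z (i, x) e, fun X i j => ?_⟩
  have hX : N X i j = ∑ x, ∑ y, X x y * J (i, x) (j, y) := by
    conv_lhs => rw [Matrix.matrix_eq_sum_single X]
    simp only [map_sum, Matrix.sum_apply]
    refine Finset.sum_congr rfl fun x _ => Finset.sum_congr rfl fun y _ => ?_
    have : Matrix.single x y (X x y) = X x y • Matrix.single x y (1 : ℂ) := by simp
    rw [this, map_smul, Matrix.smul_apply, smul_eq_mul, hJdef, Matrix.of_apply]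
  rw [hX, hZZ]
  simp only [Matrix.mul_apply, Matrix.conjTranspose_apply, Matrix.of_apply, Finset.mul_sum]
  conv_rhs => rw [Finset.sum_comm]; enter [2, x]; rw [Finset.sum_comm]
  refine Finset.sum_congr rfl fun x _ => Finset.sum_congr rfl fun y _ =>
    Finset.sum_congr rfl fun e _ => ?_
  ring

theorem isKraus_tensorChannel {A₁ B₁ E₁ A₂ B₂ E₂ : Type*}
    [Fintype A₁] [DecidableEq A₁] [Fintype B₁] [DecidableEq B₁] [Fintype E₁]
    [Fintype A₂] [DecidableEq A₂] [Fintype B₂] [DecidableEq B₂] [Fintype E₂]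
    {N : Matrix A₁ A₁ ℂ →ₗ[ℂ] Matrix B₁ B₁ ℂ} {M : Matrix A₂ A₂ ℂ →ₗ[ℂ] Matrix B₂ B₂ ℂ}
    {L₁ : E₁ → Matrix B₁ A₁ ℂ} {L₂ : E₂ → Matrix B₂ A₂ ℂ}
    (h₁ : IsKraus N L₁) (h₂ : IsKraus M L₂) :
    IsKraus (tensorChannel N M) (fun e : E₁ × E₂ => L₁ e.1 ⊗ₖ L₂ e.2) := by
  rintro X ⟨i₁, i₂⟩ ⟨j₁, j₂⟩
  change M (Matrix.of fun x y => N (Matrix.of fun x' y' => X (x', x) (y', y)) i₁ j₁) i₂ j₂ = _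
  rw [h₂]
  simp only [Matrix.of_apply, h₁ _ i₁ j₁, Fintype.sum_prod_type, Matrix.kronecker_apply,
    Finset.mul_sum, Finset.sum_mul, star_mul']
  simp only [← Fintype.sum_prod_type']
  let e : E₂ × A₂ × A₂ × E₁ × A₁ × A₁ ≃ E₁ × E₂ × A₁ × A₂ × A₁ × A₂ :=
    { toFun := fun p => (p.2.2.2.1, p.1, p.2.2.2.2.1, p.2.1, p.2.2.2.2.2, p.2.2.1)
      invFun := fun p => (p.2.1, p.2.2.2.1, p.2.2.2.2.2, p.1, p.2.2.1, p.2.2.2.2.1)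
      left_inv := fun _ => rfl
      right_inv := fun _ => rfl }
  refine Fintype.sum_equiv e _ _ fun p => ?_
  simp only [e, Equiv.coe_fn_mk]
  ring

end Kraus

section Values

variable {A B E : Type} [Fintype A] [DecidableEq A] [Fintype B] [DecidableEq B]
  [Fintype E] [DecidableEq E]

/-- The values of `Tr (L^c X)^α` over all ancillas and positive `X` with `Tr X^α = 1`,
where `L^c` is the complementary map. -/
def complValues (α : ℝ) (L : E → Matrix B A ℂ) : Set ℝ :=
  {v | ∃ (C : Type) (_ : Fintype C) (_ : DecidableEq C) (X : Matrix (A × C) (A × C) ℂ),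
    X.PosSemidef ∧ trp α X = 1 ∧ v = trp α (complMap L X)}

theorem complValues_nonneg {α : ℝ} {L : E → Matrix B A ℂ} {v : ℝ} (hv : v ∈ complValues α L) :
    0 ≤ v := by
  obtain ⟨C, _, _, X, hX, -, rfl⟩ := hv
  exact trp_nonneg (complMap_posSemidef L hX) α

theorem div_mem_complValues {α : ℝ} (hα : α ≠ 0) (L : E → Matrix B A ℂ) {C : Type} [Fintype C]
    [DecidableEq C] {X : Matrix (A × C) (A × C) ℂ} (hX : X.PosSemidef) (h0 : trp α X ≠ 0) :
    trp α (complMap L X) / trp α X ∈ complValues α L := by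
  have ht := trp_nonneg hX α
  set t := trp α X with ht_def
  have hc : 0 ≤ t ^ (-α⁻¹) := Real.rpow_nonneg ht _
  have hcα : (t ^ (-α⁻¹)) ^ α = t⁻¹ := by
    rw [← Real.rpow_mul ht, neg_mul, inv_mul_cancel₀ hα, Real.rpow_neg_one]
  refine ⟨C, inferInstance, inferInstance, ((t ^ (-α⁻¹) : ℝ) : ℂ) • X,
    hX.smul (by exact_mod_cast hc), ?_, ?_⟩
  · rw [trp_smul hX hc, hcα, ← ht_def, inv_mul_cancel₀ h0]
  · rw [complMap_smul, trp_smul (complMap_posSemidef L hX) hc, hcα, div_eq_inv_mul]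

theorem complValues_nonempty [Nonempty A] {α : ℝ} (hα : α ≠ 0) (L : E → Matrix B A ℂ) :
    (complValues α L).Nonempty :=
  ⟨_, div_mem_complValues hα L (C := Unit) Matrix.PosSemidef.one (by
    rw [trp_one]; exact_mod_cast Fintype.card_ne_zero)⟩

theorem rtr_eq_one {n : Type*} [Fintype n] {A : Matrix n n ℂ} (hA : A.PosSemidef) :
    rtr A = 1 ↔ A.trace = 1 := by
  have h := (Complex.nonneg_iff.mp hA.trace_nonneg).2
  rw [rtr, Complex.ext_iff, ← h]
  simp

theorem trace_reduced {A C R : Type*} [Fintype A] [Fintype C] [Fintype R]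
    (Ψ : Matrix R (A × C) ℂ) : (reduced Ψ).trace = (Ψ.conjTranspose * Ψ).trace := by
  simp only [Matrix.trace, Matrix.diag, reduced, Matrix.of_apply, Matrix.mul_apply,
    Matrix.conjTranspose_apply, Fintype.sum_prod_type]
  refine Finset.sum_congr rfl fun x _ => ?_
  rw [Finset.sum_comm]
  simp only [mul_comm]

theorem reduced_posSemidef {A C R : Type*} [Fintype A] [Fintype C] [Fintype R]
    (Ψ : Matrix R (A × C) ℂ) : (reduced Ψ).PosSemidef := by
  have h : reduced Ψ = (Matrix.of fun (p : A × R) c => Ψ p.2 (p.1, c))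
      * (Matrix.of fun (p : A × R) c => Ψ p.2 (p.1, c)).conjTranspose := by
    ext p q
    simp [reduced, Matrix.mul_apply]
  rw [h]
  exact Matrix.posSemidef_self_mul_conjTranspose _

theorem exists_complValues_of_isState {N : Matrix A A ℂ →ₗ[ℂ] Matrix B B ℂ}
    {L : E → Matrix B A ℂ} (hL : IsKraus N L) {α : ℝ} (hα : 0 < α) (hα1 : α ≠ 1) {k : ℕ}
    {ρ : Matrix (A × Fin k) (A × Fin k) ℂ} (hρ : IsState ρ) :
    ∃ v ∈ complValues α L,
      sandTr α (tensorId N (Fin k) ρ) (tensorId (randomizing A B) (Fin k) ρ)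
        = (Fintype.card B : ℝ) ^ (α - 1) * v := by
  set S := mpow ρ 2⁻¹ with hS
  have hSh : S.conjTranspose = S := (mpow_posSemidef hρ.1 _).1
  have hSS : ρ = S * S.conjTranspose := by
    rw [hSh, hS, mpow_mul_mpow hρ.1 (by norm_num)]
    norm_num [mpow_one hρ.1]
  set Ψ : Matrix (Fin k) (A × (A × Fin k)) ℂ := Matrix.of fun r p => S (p.1, r) p.2 with hΨ
  have hred : ρ = reduced Ψ := by
    conv_lhs => rw [hSS]
    ext p q
    simp [reduced, Matrix.mul_apply, hΨ]
  have hΨΨ := Matrix.posSemidef_conjTranspose_mul_self Ψ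
  refine ⟨_, ⟨A × Fin k, inferInstance, inferInstance, mpow (Ψ.conjTranspose * Ψ) α⁻¹,
    mpow_posSemidef hΨΨ _, ?_, rfl⟩, ?_⟩
  · rw [trp, mpow_mpow hΨΨ, inv_mul_cancel₀ hα.ne', mpow_one hΨΨ, rtr_eq_one hΨΨ,
      ← trace_reduced, ← hred, hρ.2]
  · conv_lhs => rw [hred]
    exact sandTr_reduced hL Ψ hα hα1

theorem exists_isState_of_mem_complValues {N : Matrix A A ℂ →ₗ[ℂ] Matrix B B ℂ}
    {L : E → Matrix B A ℂ} (hL : IsKraus N L) {α : ℝ} (hα : 0 < α) (hα1 : α ≠ 1) {v : ℝ}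
    (hv : v ∈ complValues α L) :
    ∃ (k : ℕ) (ρ : Matrix (A × Fin k) (A × Fin k) ℂ), IsState ρ ∧
      sandTr α (tensorId N (Fin k) ρ) (tensorId (randomizing A B) (Fin k) ρ)
        = (Fintype.card B : ℝ) ^ (α - 1) * v := by
  obtain ⟨C, _, _, X, hX, hX1, rfl⟩ := hv
  set ω := mpow X α with hω
  have hωp : ω.PosSemidef := mpow_posSemidef hX α
  set S := mpow ω 2⁻¹ with hS
  have hSh : S.conjTranspose = S := (mpow_posSemidef hωp _).1
  have hSS : S.conjTranspose * S = ω := by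
    rw [hSh, hS, mpow_mul_mpow hωp (by norm_num)]
    norm_num [mpow_one hωp]
  set σ := Fintype.equivFin (A × C)
  set Ψ : Matrix (Fin (Fintype.card (A × C))) (A × C) ℂ := S.submatrix σ.symm id with hΨ
  have hΨΨ : Ψ.conjTranspose * Ψ = ω := by
    rw [hΨ, Matrix.conjTranspose_submatrix, Matrix.submatrix_mul_equiv, hSS,
      Matrix.submatrix_id_id]
  refine ⟨_, reduced Ψ, ⟨reduced_posSemidef Ψ, ?_⟩, ?_⟩
  · rw [trace_reduced, hΨΨ, ← rtr_eq_one hωp]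
    exact hX1
  · rw [sandTr_reduced hL Ψ hα hα1, hΨΨ, hω, mpow_mpow hX, mul_inv_cancel₀ hα.ne', mpow_one hX]

/-- `s` is the supremum (for `1 < α`) or infimum (for `α < 1`) of `V`. -/
def IsOpt (α : ℝ) (V : Set ℝ) (s : ℝ) : Prop :=
  s ∈ closure V ∧ ∀ v ∈ V, (α - 1) * v ≤ (α - 1) * s

theorem exists_isOpt_complValues [Nonempty A] {α : ℝ} (hα : 0 < α)
    (L : E → Matrix B A ℂ) : ∃ s, IsOpt α (complValues α L) s := by
  have hne := complValues_nonempty hα.ne' L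
  rcases lt_or_ge 1 α with h | h
  · obtain ⟨κ, hκ⟩ := exists_trp_complMap_le L h
    have hbdd : BddAbove (complValues α L) := by
      refine ⟨κ, ?_⟩
      rintro _ ⟨C, _, _, X, hX, hX1, rfl⟩
      simpa [hX1] using hκ C X hX
    exact ⟨_, csSup_mem_closure hne hbdd, fun v hv =>
      mul_le_mul_of_nonneg_left (le_csSup hbdd hv) (by linarith)⟩
  · have hbdd : BddBelow (complValues α L) := ⟨0, fun _ => complValues_nonneg⟩
    exact ⟨_, csInf_mem_closure hne hbdd, fun v hv =>
      mul_le_mul_of_nonpos_left (csInf_le hbdd hv) (by linarith)⟩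

theorem IsOpt.nonneg {α s : ℝ} {L : E → Matrix B A ℂ} (hs : IsOpt α (complValues α L) s) :
    0 ≤ s :=
  closure_minimal (fun _ => complValues_nonneg) isClosed_Ici hs.1

theorem IsOpt.mul_trp_complMap_le {α s : ℝ} (hα : 0 < α) {L : E → Matrix B A ℂ}
    (hs : IsOpt α (complValues α L) s) {C : Type} [Fintype C] [DecidableEq C]
    {X : Matrix (A × C) (A × C) ℂ} (hX : X.PosSemidef) :
    (α - 1) * trp α (complMap L X) ≤ (α - 1) * (s * trp α X) := by
  have hY := trp_nonneg (complMap_posSemidef L hX) α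
  by_cases h0 : trp α X = 0
  · rw [h0, mul_zero, mul_zero]
    rcases lt_or_ge 1 α with h | h
    · obtain ⟨κ, hκ⟩ := exists_trp_complMap_le L h
      have := hκ C X hX
      rw [h0, mul_zero] at this
      exact mul_nonpos_of_nonneg_of_nonpos (by linarith) this
    · exact mul_nonpos_of_nonpos_of_nonneg (by linarith) hY
  · have h := mul_le_mul_of_nonneg_right (hs.2 _ (div_mem_complValues hα.ne' L hX h0))
      (trp_nonneg hX α)
    rwa [mul_assoc, div_mul_cancel₀ _ h0, mul_assoc] at h

theorem chTsallisEnt_eq_of_isOpt [Nonempty A] [Nonempty B]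
    {N : Matrix A A ℂ →ₗ[ℂ] Matrix B B ℂ} {L : E → Matrix B A ℂ} (hL : IsKraus N L) {α s : ℝ}
    (hα : 0 < α) (hα1 : α ≠ 1) (hs : IsOpt α (complValues α L) s) :
    chTsallisEnt α N = (s - 1) / (1 - α) := by
  have hB : (0 : ℝ) < Fintype.card B := by exact_mod_cast Fintype.card_pos
  set c := (Fintype.card B : ℝ) ^ (α - 1) with hc
  have hc0 : 0 < c := Real.rpow_pos_of_pos hB _
  have hcc : (Fintype.card B : ℝ) ^ (1 - α) * c = 1 := by
    rw [hc, ← Real.rpow_add hB]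
    simp
  have hne : α - 1 ≠ 0 := sub_ne_zero.mpr hα1
  set f : ℝ → ℝ := fun q => (α - 1)⁻¹ * (c * q - 1) with hf
  have hmono : ∀ v ∈ complValues α L, f v ≤ f s := by
    intro v hv
    have h : 0 ≤ c * ((α - 1)⁻¹ ^ 2 * ((α - 1) * s - (α - 1) * v)) :=
      mul_nonneg hc0.le (mul_nonneg (sq_nonneg _) (sub_nonneg.mpr (hs.2 v hv)))
    have h2 : c * ((α - 1)⁻¹ ^ 2 * ((α - 1) * s - (α - 1) * v)) = f s - f v := by
      rw [hf]
      field_simp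
      ring
    linarith
  have hlub : IsLUB (Set.range fun p : Σ k : ℕ,
      {ρ : Matrix (A × Fin k) (A × Fin k) ℂ // IsState ρ} =>
      sandTsallis α (tensorId N (Fin p.1) p.2.1) (tensorId (randomizing A B) (Fin p.1) p.2.1))
      (f s) := by
    refine isLUB_of_mem_closure ?_ ?_
    · rintro _ ⟨⟨k, ρ, hρ⟩, rfl⟩
      obtain ⟨v, hv, h⟩ := exists_complValues_of_isState hL hα hα1 hρ
      simpa only [sandTsallis, h] using hmono v hv
    · refine map_mem_closure (f := f) (by fun_prop) hs.1 fun v hv => ?_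
      obtain ⟨k, ρ, hρ, h⟩ := exists_isState_of_mem_complValues hL hα hα1 hv
      exact ⟨⟨k, ρ, hρ⟩, by simp only [sandTsallis, h, hf, hc]⟩
  have hnonempty : (Set.range fun p : Σ k : ℕ,
      {ρ : Matrix (A × Fin k) (A × Fin k) ℂ // IsState ρ} =>
      sandTsallis α (tensorId N (Fin p.1) p.2.1)
        (tensorId (randomizing A B) (Fin p.1) p.2.1)).Nonempty := by
    obtain ⟨v, hv⟩ := complValues_nonempty (A := A) hα.ne' L
    obtain ⟨k, ρ, hρ, -⟩ := exists_isState_of_mem_complValues hL hα hα1 hv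
    exact ⟨_, ⟨⟨k, ρ, hρ⟩, rfl⟩⟩
  have hch : chSandTsallis α N (randomizing A B) = f s := hlub.csSup_eq hnonempty
  have hne' : 1 - α ≠ 0 := sub_ne_zero.mpr (Ne.symm hα1)
  have hfs : (Fintype.card B : ℝ) ^ (1 - α) * f s
      = (s - (Fintype.card B : ℝ) ^ (1 - α)) / (α - 1) := by
    rw [hf]
    calc _ = (((Fintype.card B : ℝ) ^ (1 - α) * c) * s - (Fintype.card B : ℝ) ^ (1 - α))
          / (α - 1) := by field_simp
      _ = _ := by rw [hcc, one_mul]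
  rw [chTsallisEnt, hch, hfs, ← neg_sub 1 α, div_neg, sub_neg_eq_add, ← add_div]
  congr 1
  ring

end Values

section Tensor

variable {A₁ B₁ E₁ A₂ B₂ E₂ : Type} [Fintype A₁] [DecidableEq A₁] [Fintype B₁] [DecidableEq B₁]
  [Fintype E₁] [DecidableEq E₁] [Fintype A₂] [DecidableEq A₂] [Fintype B₂] [DecidableEq B₂]
  [Fintype E₂] [DecidableEq E₂]

/-- The reordering `X ⊗ (Y ⊗ Z) ≃ Y ⊗ (X ⊗ Z)` of tensor factors. -/
def prodLeftComm (X Y Z : Type*) : X × (Y × Z) ≃ Y × (X × Z) where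
  toFun p := (p.2.1, (p.1, p.2.2))
  invFun p := (p.2.1, (p.1, p.2.2))
  left_inv _ := rfl
  right_inv _ := rfl

theorem complMap_tensor (L₁ : E₁ → Matrix B₁ A₁ ℂ) (L₂ : E₂ → Matrix B₂ A₂ ℂ)
    {C : Type} [Fintype C] [DecidableEq C]
    (X : Matrix ((A₁ × A₂) × C) ((A₁ × A₂) × C) ℂ) :
    complMap (fun e : E₁ × E₂ => L₁ e.1 ⊗ₖ L₂ e.2) X
      = (complMap L₁ ((complMap L₂ (X.submatrix
            ((prodLeftComm A₂ A₁ C).trans (Equiv.prodAssoc A₁ A₂ C).symm)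
            ((prodLeftComm A₂ A₁ C).trans (Equiv.prodAssoc A₁ A₂ C).symm))).submatrix
          (prodLeftComm A₁ E₂ C) (prodLeftComm A₁ E₂ C))).submatrix
        (Equiv.prodAssoc E₁ E₂ C) (Equiv.prodAssoc E₁ E₂ C) := by
  ext ⟨⟨e₁, e₂⟩, c⟩ ⟨⟨e₁', e₂'⟩, c'⟩
  simp only [Matrix.submatrix_apply, complMap_apply, Equiv.prodAssoc_apply, prodLeftComm,
    Equiv.coe_fn_mk, Equiv.coe_trans, Function.comp_apply, Equiv.prodAssoc_symm_apply,
    Matrix.kronecker_apply, Fintype.sum_prod_type, Finset.mul_sum, Finset.sum_mul, star_mul']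
  simp only [← Fintype.sum_prod_type']
  let e : B₁ × B₂ × A₁ × A₂ × A₁ × A₂ ≃ B₁ × A₁ × A₁ × B₂ × A₂ × A₂ :=
    { toFun := fun p => (p.1, p.2.2.1, p.2.2.2.2.1, p.2.1, p.2.2.2.1, p.2.2.2.2.2)
      invFun := fun p => (p.1, p.2.2.2.1, p.2.1, p.2.2.2.2.1, p.2.2.1, p.2.2.2.2.2)
      left_inv := fun _ => rfl
      right_inv := fun _ => rfl }
  refine Fintype.sum_equiv e _ _ fun p => ?_
  simp only [e, Equiv.coe_fn_mk]
  ring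

theorem complMap_kronecker {C₁ C₂ : Type} [Fintype C₁] [DecidableEq C₁] [Fintype C₂]
    [DecidableEq C₂] (L₁ : E₁ → Matrix B₁ A₁ ℂ) (L₂ : E₂ → Matrix B₂ A₂ ℂ)
    (X₁ : Matrix (A₁ × C₁) (A₁ × C₁) ℂ) (X₂ : Matrix (A₂ × C₂) (A₂ × C₂) ℂ) :
    complMap (fun e : E₁ × E₂ => L₁ e.1 ⊗ₖ L₂ e.2) ((X₁ ⊗ₖ X₂).submatrix
        (Equiv.prodProdProdComm A₁ A₂ C₁ C₂) (Equiv.prodProdProdComm A₁ A₂ C₁ C₂))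
      = (complMap L₁ X₁ ⊗ₖ complMap L₂ X₂).submatrix
        (Equiv.prodProdProdComm E₁ E₂ C₁ C₂) (Equiv.prodProdProdComm E₁ E₂ C₁ C₂) := by
  ext ⟨⟨e₁, e₂⟩, c⟩ ⟨⟨e₁', e₂'⟩, c'⟩
  simp only [Matrix.submatrix_apply, complMap_apply, Equiv.prodProdProdComm_apply,
    Matrix.kronecker_apply, Fintype.sum_prod_type, Finset.mul_sum, Finset.sum_mul, star_mul']
  simp only [← Fintype.sum_prod_type']
  let e : B₁ × B₂ × A₁ × A₂ × A₁ × A₂ ≃ B₂ × A₂ × A₂ × B₁ × A₁ × A₁ :=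
    { toFun := fun p => (p.2.1, p.2.2.2.1, p.2.2.2.2.2, p.1, p.2.2.1, p.2.2.2.2.1)
      invFun := fun p => (p.2.2.2.1, p.1, p.2.2.2.2.1, p.2.1, p.2.2.2.2.2, p.2.2.1)
      left_inv := fun _ => rfl
      right_inv := fun _ => rfl }
  refine Fintype.sum_equiv e _ _ fun p => ?_
  simp only [e, Equiv.coe_fn_mk]
  ring

theorem mul_mem_complValues {α v₁ v₂ : ℝ} {L₁ : E₁ → Matrix B₁ A₁ ℂ}
    {L₂ : E₂ → Matrix B₂ A₂ ℂ} (h₁ : v₁ ∈ complValues α L₁) (h₂ : v₂ ∈ complValues α L₂) :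
    v₁ * v₂ ∈ complValues α (fun e : E₁ × E₂ => L₁ e.1 ⊗ₖ L₂ e.2) := by
  obtain ⟨C₁, _, _, X₁, hX₁, hX₁1, rfl⟩ := h₁
  obtain ⟨C₂, _, _, X₂, hX₂, hX₂1, rfl⟩ := h₂
  have hX := hX₁.kronecker hX₂
  refine ⟨C₁ × C₂, inferInstance, inferInstance, _,
    hX.submatrix (Equiv.prodProdProdComm A₁ A₂ C₁ C₂), ?_, ?_⟩
  · rw [trp_submatrix hX, trp_kronecker hX₁ hX₂, hX₁1, hX₂1, one_mul]
  · have hY₁ := complMap_posSemidef L₁ hX₁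
    have hY₂ := complMap_posSemidef L₂ hX₂
    rw [complMap_kronecker, trp_submatrix (hY₁.kronecker hY₂), trp_kronecker hY₁ hY₂]

theorem IsOpt.tensor {α s₁ s₂ : ℝ} (hα : 0 < α) {L₁ : E₁ → Matrix B₁ A₁ ℂ}
    {L₂ : E₂ → Matrix B₂ A₂ ℂ} (h₁ : IsOpt α (complValues α L₁) s₁)
    (h₂ : IsOpt α (complValues α L₂) s₂) :
    IsOpt α (complValues α (fun e : E₁ × E₂ => L₁ e.1 ⊗ₖ L₂ e.2)) (s₁ * s₂) := by
  refine ⟨map_mem_closure₂ continuous_mul h₁.1 h₂.1 fun _ ha _ hb => mul_mem_complValues ha hb, ?_⟩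
  rintro _ ⟨C, _, _, X, hX, hX1, rfl⟩
  set X₂ := X.submatrix ((prodLeftComm A₂ A₁ C).trans (Equiv.prodAssoc A₁ A₂ C).symm)
    ((prodLeftComm A₂ A₁ C).trans (Equiv.prodAssoc A₁ A₂ C).symm) with hX₂
  have hX₂p : X₂.PosSemidef := hX.submatrix _
  have hX₂1 : trp α X₂ = 1 := by rw [hX₂, trp_submatrix hX, hX1]
  have hY := complMap_posSemidef L₂ hX₂p
  have hY' := hY.submatrix (prodLeftComm A₁ E₂ C)
  rw [complMap_tensor, ← hX₂, trp_submatrix (complMap_posSemidef L₁ hY')]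
  have e₁ := h₁.mul_trp_complMap_le hα hY'
  have e₂ := mul_le_mul_of_nonneg_left (h₂.mul_trp_complMap_le hα hX₂p) h₁.nonneg
  rw [trp_submatrix hY] at e₁
  rw [hX₂1] at e₂
  linarith

end Tensor

theorem chTsallisEnt_pseudo_additive {A₁ B₁ A₂ B₂ : Type}
    [Fintype A₁] [DecidableEq A₁] [Nonempty A₁] [Fintype B₁] [DecidableEq B₁] [Nonempty B₁]
    [Fintype A₂] [DecidableEq A₂] [Nonempty A₂] [Fintype B₂] [DecidableEq B₂] [Nonempty B₂]
    (α : ℝ) (hα : α ∈ Set.Ico (2⁻¹ : ℝ) 1 ∪ Set.Ioi 1)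
    (N : Matrix A₁ A₁ ℂ →ₗ[ℂ] Matrix B₁ B₁ ℂ) (hN : IsChannel N)
    (M : Matrix A₂ A₂ ℂ →ₗ[ℂ] Matrix B₂ B₂ ℂ) (hM : IsChannel M) :
    chTsallisEnt α (tensorChannel N M)
      = chTsallisEnt α N + chTsallisEnt α M
        + (1 - α) * chTsallisEnt α N * chTsallisEnt α M := by
  have hα0 : 0 < α := by
    rcases hα with h | h
    · exact lt_of_lt_of_le (by norm_num) h.1
    · exact zero_lt_one.trans h
  have hα1 : α ≠ 1 := by
    rcases hα with h | h
    · exact h.2.ne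
    · exact (show 1 < α from h).ne'
  obtain ⟨L₁, hL₁⟩ := exists_isKraus hN
  obtain ⟨L₂, hL₂⟩ := exists_isKraus hM
  obtain ⟨s₁, h₁⟩ := exists_isOpt_complValues hα0 L₁
  obtain ⟨s₂, h₂⟩ := exists_isOpt_complValues hα0 L₂
  rw [chTsallisEnt_eq_of_isOpt hL₁ hα0 hα1 h₁, chTsallisEnt_eq_of_isOpt hL₂ hα0 hα1 h₂,
    chTsallisEnt_eq_of_isOpt (isKraus_tensorChannel hL₁ hL₂) hα0 hα1 (h₁.tensor hα0 h₂)]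
  have hne : 1 - α ≠ 0 := sub_ne_zero.mpr (Ne.symm hα1)
  field_simp
  ring

end QIT
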